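/- arXiv:2312.11960 — 8 statements merged into one kernel-verified Lean document; each statement's English description precedes it below -/
import Mathlib

section
/- Let G=(V,E⁺,E⁻) be a connected signed graph. If G has a non-trivial offensive alliance (i.e., a nonempty offensive alliance S with S ≠ V), then Δ⁻(G) ≥ ⌈(δ⁺(G)+1)/2⌉. -/
/-- A signed graph on a vertex type `V`: a set of positive edges and a set of
negative edges, given as two simple graphs with disjoint edge sets. -/
structure SignedGraph (V : Type*) where
  pos : SimpleGraph V
  neg : SimpleGraph V
  disj : ∀ u v : V, ¬ (pos.Adj u v ∧ neg.Adj u v)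

namespace SignedGraph

variable {V : Type*}

/-- The positive neighborhood `N⁺(v)`. -/
def Np (G : SignedGraph V) (v : V) : Set V := {u | G.pos.Adj v u}

/-- The negative neighborhood `N⁻(v)`. -/
def Nn (G : SignedGraph V) (v : V) : Set V := {u | G.neg.Adj v u}

/-- The (open) neighborhood `N(v) = N⁺(v) ∪ N⁻(v)`. -/
def Nbr (G : SignedGraph V) (v : V) : Set V := G.Np v ∪ G.Nn v

/-- The positive degree `deg⁺(v)`. -/
noncomputable def degp (G : SignedGraph V) (v : V) : ℕ := (G.Np v).ncard

/-- The negative degree `deg⁻(v)`. -/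
noncomputable def degn (G : SignedGraph V) (v : V) : ℕ := (G.Nn v).ncard

/-- The positive degree with respect to a set `S`: `deg⁺_S(v) = |N⁺(v) ∩ S|`. -/
noncomputable def degpIn (G : SignedGraph V) (S : Set V) (v : V) : ℕ := (G.Np v ∩ S).ncard

/-- The negative degree with respect to a set `S`: `deg⁻_S(v) = |N⁻(v) ∩ S|`. -/
noncomputable def degnIn (G : SignedGraph V) (S : Set V) (v : V) : ℕ := (G.Nn v ∩ S).ncard

/-- The boundary `∂S = (⋃_{v ∈ S} N(v)) \ S`. -/
def boundary (G : SignedGraph V) (S : Set V) : Set V := (⋃ v ∈ S, G.Nbr v) \ S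

/-- `S` is an offensive alliance: every boundary vertex `v` satisfies
`deg⁻_S(v) ≥ deg⁺_S(v)` and `deg⁻_S(v) ≥ deg⁺_{S̄}(v) + 1`. -/
def IsOffensive (G : SignedGraph V) (S : Set V) : Prop :=
  ∀ v ∈ G.boundary S,
    G.degpIn S v ≤ G.degnIn S v ∧ G.degpIn Sᶜ v + 1 ≤ G.degnIn S v

/-- The offensive alliance number `a_so(G)`: the least size of a nonempty offensive alliance. -/
noncomputable def aso (G : SignedGraph V) : ℕ :=
  sInf {n | ∃ S : Set V, S.Nonempty ∧ G.IsOffensive S ∧ S.ncard = n}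

/-- `S` is a minimum-size nonempty offensive alliance. -/
def IsMinOffensive (G : SignedGraph V) (S : Set V) : Prop :=
  S.Nonempty ∧ G.IsOffensive S ∧
    ∀ T : Set V, T.Nonempty → G.IsOffensive T → S.ncard ≤ T.ncard

/-- The minimum positive degree `δ⁺(G)`. -/
noncomputable def minPosDeg (G : SignedGraph V) : ℕ := sInf (Set.range G.degp)

/-- The maximum negative degree `Δ⁻(G)`. -/
noncomputable def maxNegDeg (G : SignedGraph V) : ℕ := sSup (Set.range G.degn)

/-- The underlying unsigned graph `(V, E⁺ ∪ E⁻)`. -/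
def underlying (G : SignedGraph V) : SimpleGraph V := G.pos ⊔ G.neg

/-- `G` is connected if its underlying unsigned graph is connected. -/
def Connected (G : SignedGraph V) : Prop := G.underlying.Connected

/-- `G` is a complete signed graph that is (weakly) `k`-balanced with positive components
`P 0, …, P (k-1)`: the `P i` are nonempty, pairwise disjoint, cover `V`, the positive edges
are exactly the pairs of distinct vertices inside a common part, and the negative edges are
exactly the pairs of distinct vertices in no common part. -/
def IsKBalanced (G : SignedGraph V) (k : ℕ) (P : Fin k → Set V) : Prop :=
  (∀ i, (P i).Nonempty) ∧
  (∀ i j : Fin k, i ≠ j → Disjoint (P i) (P j)) ∧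
  (⋃ i, P i) = Set.univ ∧
  (∀ u v : V, G.pos.Adj u v ↔ u ≠ v ∧ ∃ i, u ∈ P i ∧ v ∈ P i) ∧
  (∀ u v : V, G.neg.Adj u v ↔ u ≠ v ∧ ¬ ∃ i, u ∈ P i ∧ v ∈ P i)

/-- `G` is a complete signed graph that is (weakly) `k`-anti-balanced with negative components
`P 0, …, P (k-1)`. -/
def IsKAntiBalanced (G : SignedGraph V) (k : ℕ) (P : Fin k → Set V) : Prop :=
  (∀ i, (P i).Nonempty) ∧
  (∀ i j : Fin k, i ≠ j → Disjoint (P i) (P j)) ∧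
  (⋃ i, P i) = Set.univ ∧
  (∀ u v : V, G.neg.Adj u v ↔ u ≠ v ∧ ∃ i, u ∈ P i ∧ v ∈ P i) ∧
  (∀ u v : V, G.pos.Adj u v ↔ u ≠ v ∧ ¬ ∃ i, u ∈ P i ∧ v ∈ P i)

/-- `V` can be partitioned into `t` classes such that vertices in a common class have the same
positive neighborhoods and the same negative neighborhoods (up to each other). -/
def GoodSndPartition (G : SignedGraph V) (t : ℕ) : Prop :=
  ∃ C : Fin t → Set V,
    (⋃ i, C i) = Set.univ ∧
    (∀ i j : Fin t, i ≠ j → Disjoint (C i) (C j)) ∧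
    ∀ i : Fin t, ∀ u ∈ C i, ∀ v ∈ C i,
      G.Np v \ {u} = G.Np u \ {v} ∧ G.Nn v \ {u} = G.Nn u \ {v}

/-- The signed neighborhood diversity `snd(G)`. -/
noncomputable def snd (G : SignedGraph V) : ℕ := sInf {t | G.GoodSndPartition t}

/-- The signed subgraph induced on a set `W` of vertices. -/
def restrict (G : SignedGraph V) (W : Set V) : SignedGraph W where
  pos := G.pos.induce W
  neg := G.neg.induce W
  disj := fun u v h => G.disj u.val v.val h

end SignedGraph

namespace SignedGraph

theorem Connected.boundary_nonempty {V : Type*} {G : SignedGraph V} (hG : G.Connected)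
    {S : Set V} (hS : S.Nonempty) (hS' : S ≠ Set.univ) : (G.boundary S).Nonempty := by
  obtain ⟨u, hu⟩ := hS
  obtain ⟨w, hw⟩ := (Set.ne_univ_iff_exists_notMem S).1 hS'
  obtain ⟨p⟩ := SimpleGraph.Connected.preconnected hG u w
  obtain ⟨d, -, hd, hd'⟩ := p.exists_boundary_dart S hu hw
  exact ⟨d.snd, Set.mem_biUnion hd d.adj, hd'⟩

theorem degpIn_add_degpIn_compl {V : Type*} [Finite V] (G : SignedGraph V) (S : Set V) (v : V) :
    G.degpIn S v + G.degpIn Sᶜ v = G.degp v :=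
  Set.ncard_inter_add_ncard_sdiff_eq_ncard (G.Np v) S (Set.toFinite _)

theorem degnIn_le_degn {V : Type*} [Finite V] (G : SignedGraph V) (S : Set V) (v : V) :
    G.degnIn S v ≤ G.degn v :=
  Set.ncard_le_ncard Set.inter_subset_left (Set.toFinite _)

theorem minPosDeg_le_degp {V : Type*} (G : SignedGraph V) (v : V) : G.minPosDeg ≤ G.degp v :=
  Nat.sInf_le ⟨v, rfl⟩

theorem degn_le_maxNegDeg {V : Type*} [Finite V] (G : SignedGraph V) (v : V) :
    G.degn v ≤ G.maxNegDeg :=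
  le_csSup (Set.finite_range _).bddAbove ⟨v, rfl⟩

end SignedGraph

theorem signed_offensive_degree_condition {V : Type*} [Fintype V]
    (G : SignedGraph V) (hconn : G.Connected)
    (hex : ∃ S : Set V, S.Nonempty ∧ G.IsOffensive S ∧ S ≠ Set.univ) :
    (G.minPosDeg + 2) / 2 ≤ G.maxNegDeg := by
  obtain ⟨S, hS, hoff, hS'⟩ := hex
  obtain ⟨v, hv⟩ := hconn.boundary_nonempty hS hS'
  obtain ⟨h₁, h₂⟩ := hoff v hv
  have hsplit := G.degpIn_add_degpIn_compl S v
  have hneg := G.degnIn_le_degn S v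
  have hmin := G.minPosDeg_le_degp v
  have hmax := G.degn_le_maxNegDeg v
  omega
end

section
/- If S is a minimum-size nonempty offensive alliance of a signed graph G=(V,E⁺,E⁻) (i.e., S is a nonempty offensive alliance and no nonempty offensive alliance has fewer vertices), then the set S∪∂S induces a connected subgraph of the underlying unsigned graph (V,E⁺∪E⁻). -/
namespace SignedGraph

variable {V : Type*} {G : SignedGraph V} {S T : Set V} {v : V}

theorem mem_Nbr_iff {u : V} : u ∈ G.Nbr v ↔ G.underlying.Adj v u := by
  simp [Nbr, Np, Nn, underlying]

theorem mem_boundary_iff :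
    v ∈ G.boundary S ↔ (∃ u ∈ S, G.underlying.Adj u v) ∧ v ∉ S := by
  simp [boundary, mem_Nbr_iff]

/-- A subset `T` of an offensive alliance `S` is offensive if its boundary avoids `S` and
`T` contains every `S`-neighbor of each of its boundary vertices. -/
theorem IsOffensive.of_subset (hS : G.IsOffensive S) (hTS : T ⊆ S)
    (hdisj : ∀ v ∈ G.boundary T, v ∉ S)
    (hclosed : ∀ v ∈ G.boundary T, ∀ u ∈ S, G.underlying.Adj v u → u ∈ T) :
    G.IsOffensive T := by
  intro v hv
  have hvS : v ∈ G.boundary S := by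
    obtain ⟨⟨u, hu, huv⟩, -⟩ := SignedGraph.mem_boundary_iff.1 hv
    exact SignedGraph.mem_boundary_iff.2 ⟨⟨u, hTS hu, huv⟩, hdisj v hv⟩
  have hpos : ∀ u, G.pos.Adj v u → (u ∈ T ↔ u ∈ S) := fun u h =>
    ⟨fun hu => hTS hu, fun hu => hclosed v hv u hu (Or.inl h)⟩
  have hneg : ∀ u, G.neg.Adj v u → (u ∈ T ↔ u ∈ S) := fun u h =>
    ⟨fun hu => hTS hu, fun hu => hclosed v hv u hu (Or.inr h)⟩
  have hp : G.Np v ∩ T = G.Np v ∩ S := Set.ext fun u => and_congr_right (hpos u)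
  have hn : G.Nn v ∩ T = G.Nn v ∩ S := Set.ext fun u => and_congr_right (hneg u)
  have hc : G.Np v ∩ Tᶜ = G.Np v ∩ Sᶜ :=
    Set.ext fun u => and_congr_right fun h => not_congr (hpos u h)
  have := hS v hvS
  simp only [degpIn, degnIn] at this ⊢
  rwa [hp, hn, hc]

end SignedGraph

theorem signed_min_offensive_connected {V : Type*} [Fintype V]
    (G : SignedGraph V) (S : Set V) (hmin : G.IsMinOffensive S) :
    (G.underlying.induce (S ∪ G.boundary S)).Connected := by
  obtain ⟨⟨s, hs⟩, hS, hle⟩ := hmin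
  set H := G.underlying.induce (S ∪ G.boundary S)
  let s' : ↥(S ∪ G.boundary S) := ⟨s, Or.inl hs⟩
  let T : Set V := {v | ∃ hv : v ∈ S, H.Reachable s' ⟨v, Or.inl hv⟩}
  have hTS : T ⊆ S := fun v hv => hv.1
  have step : ∀ {u v : V} (hu : u ∈ S ∪ G.boundary S) (hv : v ∈ S ∪ G.boundary S),
      G.underlying.Adj u v → H.Reachable s' ⟨u, hu⟩ → H.Reachable s' ⟨v, hv⟩ :=
    fun hu hv h hr => hr.trans (SimpleGraph.Adj.reachable (G := H) h)
  have hdisj : ∀ v ∈ G.boundary T, v ∉ S := by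
    intro v hv hvS
    obtain ⟨⟨u, ⟨huS, hu⟩, huv⟩, hvT⟩ := SignedGraph.mem_boundary_iff.1 hv
    exact hvT ⟨hvS, step _ _ huv hu⟩
  have hT : G.IsOffensive T := by
    refine hS.of_subset hTS hdisj fun v hv w hw hvw => ?_
    obtain ⟨⟨u, ⟨huS, hu⟩, huv⟩, -⟩ := SignedGraph.mem_boundary_iff.1 hv
    have hvS : v ∈ S ∪ G.boundary S :=
      Or.inr (SignedGraph.mem_boundary_iff.2 ⟨⟨u, huS, huv⟩, hdisj v hv⟩)
    exact ⟨hw, step hvS _ hvw (step _ hvS huv hu)⟩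
  have hTeq : T = S :=
    Set.eq_of_subset_of_ncard_le hTS (hle T ⟨s, hs, SimpleGraph.Reachable.refl _⟩ hT)
  have hreach : ∀ v (hv : v ∈ S), H.Reachable s' ⟨v, Or.inl hv⟩ := fun v hv =>
    (hTeq.ge hv).2
  refine SimpleGraph.connected_iff_exists_forall_reachable _ |>.2 ⟨s', ?_⟩
  rintro ⟨v, hv | hv⟩
  · exact hreach v hv
  · obtain ⟨⟨u, hu, huv⟩, -⟩ := SignedGraph.mem_boundary_iff.1 hv
    exact step _ _ huv (hreach u hu)
end

section
/- Let K_n=(V,E⁺,E⁻) be a complete signed graph on n vertices that is (weakly) k-balanced (k≥1) with positive components V_1,…,V_k satisfying |V_1| ≥ |V_2| ≥ … ≥ |V_k|. Then a_so(K_n)=|V_1|, and V_1 itself is a minimum nonempty offensive alliance. -/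
namespace SignedGraph

variable {V : Type*} {G : SignedGraph V} {k : ℕ} {P : Fin k → Set V}

lemma IsKBalanced.eq_of_mem (h : G.IsKBalanced k P) {i j : Fin k} {v : V}
    (hi : v ∈ P i) (hj : v ∈ P j) : i = j := by
  by_contra hij
  exact Set.disjoint_left.mp (h.2.1 i j hij) hi hj

lemma IsKBalanced.exists_mem (h : G.IsKBalanced k P) (v : V) : ∃ i, v ∈ P i :=
  Set.mem_iUnion.mp (h.2.2.1 ▸ Set.mem_univ v)

lemma IsKBalanced.Np_eq (h : G.IsKBalanced k P) {i : Fin k} {v : V} (hv : v ∈ P i) :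
    G.Np v = P i \ {v} := by
  ext u
  simp only [Np, Set.mem_ofPred_eq, h.2.2.2.1, Set.mem_sdiff, Set.mem_singleton_iff]
  constructor
  · rintro ⟨hne, j, hvj, huj⟩
    obtain rfl := h.eq_of_mem hv hvj
    exact ⟨huj, hne.symm⟩
  · rintro ⟨hu, hne⟩
    exact ⟨Ne.symm hne, i, hv, hu⟩

lemma IsKBalanced.Nn_eq (h : G.IsKBalanced k P) {i : Fin k} {v : V} (hv : v ∈ P i) :
    G.Nn v = (P i)ᶜ := by
  ext u
  simp only [Nn, Set.mem_ofPred_eq, h.2.2.2.2, Set.mem_compl_iff]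
  constructor
  · rintro ⟨-, hn⟩ hu
    exact hn ⟨i, hv, hu⟩
  · intro hu
    refine ⟨fun e => hu (e ▸ hv), ?_⟩
    rintro ⟨j, hvj, huj⟩
    obtain rfl := h.eq_of_mem hv hvj
    exact hu huj

lemma IsKBalanced.mem_boundary (h : G.IsKBalanced k P) {S : Set V} (hS : S.Nonempty) {v : V}
    (hv : v ∉ S) : v ∈ G.boundary S := by
  obtain ⟨u, hu⟩ := hS
  refine ⟨Set.mem_biUnion hu ?_, hv⟩
  have hne : u ≠ v := fun e => hv (e ▸ hu)
  by_cases hp : ∃ i, u ∈ P i ∧ v ∈ P i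
  · exact Or.inl ((h.2.2.2.1 u v).mpr ⟨hne, hp⟩)
  · exact Or.inr ((h.2.2.2.2 u v).mpr ⟨hne, hp⟩)

/-- A part at least as large as all the others is an offensive alliance. -/
lemma IsKBalanced.isOffensive_part [Finite V] (h : G.IsKBalanced k P) {i : Fin k}
    (hi : ∀ j, (P j).ncard ≤ (P i).ncard) : G.IsOffensive (P i) := by
  rintro v ⟨-, hv⟩
  obtain ⟨j, hj⟩ := h.exists_mem v
  have hdisj : Disjoint (P j) (P i) := h.2.1 j i fun e => hv (e ▸ hj)
  have hp : G.Np v ∩ P i = ∅ := by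
    rw [h.Np_eq hj]
    exact (hdisj.mono_left Set.sdiff_subset).inter_eq
  have hpc : G.Np v ∩ (P i)ᶜ ⊆ P j \ {v} := by
    rw [h.Np_eq hj]
    exact Set.inter_subset_left
  have hn : G.Nn v ∩ P i = P i := by
    rw [h.Nn_eq hj]
    exact Set.inter_eq_right.mpr hdisj.subset_compl_left
  simp only [degpIn, degnIn, hp, hn, Set.ncard_empty, zero_le, true_and]
  have h₁ := Set.ncard_le_ncard hpc
  have h₂ := Set.ncard_sdiff_singleton_add_one hj
  have h₃ := hi j
  omega

/-- A nonempty offensive alliance is at least as large as every part. -/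
lemma IsKBalanced.ncard_part_le [Finite V] (h : G.IsKBalanced k P) (i : Fin k) {T : Set V}
    (hT : T.Nonempty) (hoff : G.IsOffensive T) : (P i).ncard ≤ T.ncard := by
  by_cases hsub : P i ⊆ T
  · exact Set.ncard_le_ncard hsub
  obtain ⟨v, hv, hvT⟩ := Set.not_subset.mp hsub
  have hle := (hoff v (h.mem_boundary hT hvT)).2
  have hp : G.Np v ∩ Tᶜ = (P i \ T) \ {v} := by
    rw [h.Np_eq hv]
    ext u
    simp only [Set.mem_inter_iff, Set.mem_sdiff, Set.mem_compl_iff]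
    tauto
  have hn : G.Nn v ∩ T = T \ P i := by
    rw [h.Nn_eq hv, Set.inter_comm, Set.sdiff_eq]
  have hvd : v ∈ P i \ T := ⟨hv, hvT⟩
  rw [degpIn, degnIn, hp, hn, Set.ncard_sdiff_singleton_add_one hvd] at hle
  have h₁ := Set.ncard_inter_add_ncard_sdiff_eq_ncard (P i) T
  have h₂ := Set.ncard_inter_add_ncard_sdiff_eq_ncard T (P i)
  rw [Set.inter_comm] at h₂
  omega

lemma IsMinOffensive.aso_eq {S : Set V} (h : G.IsMinOffensive S) : G.aso = S.ncard := by
  refine IsLeast.csInf_eq ⟨⟨S, h.1, h.2.1, rfl⟩, ?_⟩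
  rintro _ ⟨T, hT, hoff, rfl⟩
  exact h.2.2 T hT hoff

end SignedGraph

theorem signed_balanced_aso {V : Type*} [Fintype V]
    (G : SignedGraph V) (k : ℕ) (hk : 1 ≤ k) (P : Fin k → Set V)
    (hbal : G.IsKBalanced k P)
    (hsort : ∀ i j : Fin k, i ≤ j → (P j).ncard ≤ (P i).ncard) :
    G.aso = (P ⟨0, hk⟩).ncard ∧ G.IsMinOffensive (P ⟨0, hk⟩) := by
  have hmin : G.IsMinOffensive (P ⟨0, hk⟩) :=
    ⟨hbal.1 _, hbal.isOffensive_part fun j => hsort _ j (Nat.zero_le j.val),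
      fun _ hT hoff => hbal.ncard_part_le _ hT hoff⟩
  exact ⟨hmin.aso_eq, hmin⟩
end

section
/- Let K_n=(V,E⁺,E⁻) be a complete signed graph on n vertices that is (weakly) k-anti-balanced with negative components V_1,…,V_k, |V_1| ≥ … ≥ |V_k|. Assume 2|V_1| < n, and assume it is not the case that both k=2 and |V_2| ≥ ⌈(n+1)/3⌉. Then a_so(K_n) = n, i.e., the only nonempty offensive alliance of K_n is V itself. -/
namespace SignedGraph

variable {V : Type*}

lemma isOffensive_univ (G : SignedGraph V) : G.IsOffensive Set.univ :=
  fun _ hv => absurd (Set.mem_univ _) hv.2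

namespace IsKAntiBalanced

variable {G : SignedGraph V} {k : ℕ} {P : Fin k → Set V}

lemma exists_mem (h : G.IsKAntiBalanced k P) (v : V) : ∃ i, v ∈ P i := by
  simpa using h.2.2.1.symm.subset (Set.mem_univ v)

lemma eq_of_mem (h : G.IsKAntiBalanced k P) {v : V} {i j : Fin k}
    (hi : v ∈ P i) (hj : v ∈ P j) : i = j := by
  by_contra hne
  exact Set.disjoint_left.1 (h.2.1 i j hne) hi hj

lemma mem_boundary (h : G.IsKAntiBalanced k P) {S : Set V} (hS : S.Nonempty) {v : V}
    (hv : v ∉ S) : v ∈ G.boundary S := by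
  obtain ⟨u, hu⟩ := hS
  have huv : u ≠ v := fun e => hv (e ▸ hu)
  refine ⟨Set.mem_biUnion hu ?_, hv⟩
  by_cases hc : ∃ i, u ∈ P i ∧ v ∈ P i
  · exact Or.inr ((h.2.2.2.1 u v).2 ⟨huv, hc⟩)
  · exact Or.inl ((h.2.2.2.2 u v).2 ⟨huv, hc⟩)

lemma Np_eq (h : G.IsKAntiBalanced k P) {v : V} {i : Fin k} (hi : v ∈ P i) :
    G.Np v = (P i)ᶜ := by
  ext u
  refine (h.2.2.2.2 v u).trans ⟨fun hu hui => hu.2 ⟨i, hi, hui⟩, fun hu => ⟨?_, ?_⟩⟩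
  · rintro rfl
    exact hu hi
  · rintro ⟨j, hvj, huj⟩
    exact hu (h.eq_of_mem hi hvj ▸ huj)

lemma Nn_eq (h : G.IsKAntiBalanced k P) {v : V} {i : Fin k} (hi : v ∈ P i) :
    G.Nn v = P i \ {v} := by
  ext u
  refine (h.2.2.2.1 v u).trans ⟨?_, fun hu => ⟨fun e => hu.2 e.symm, i, hi, hu.1⟩⟩
  rintro ⟨hne, j, hvj, huj⟩
  exact ⟨h.eq_of_mem hi hvj ▸ huj, fun e => hne e.symm⟩

/-- If a nonempty offensive alliance misses a vertex of a negative component, then at least half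
of the alliance lies in that component. -/
lemma ncard_compl_inter_le (h : G.IsKAntiBalanced k P) {S : Set V} (hS : S.Nonempty)
    (hoff : G.IsOffensive S) {v : V} (hv : v ∉ S) {i : Fin k} (hi : v ∈ P i) :
    ((P i)ᶜ ∩ S).ncard ≤ (P i ∩ S).ncard := by
  have hle := (hoff v (h.mem_boundary hS hv)).1
  have hn : (P i \ {v}) ∩ S = P i ∩ S := by
    ext u
    exact ⟨fun hu => ⟨hu.1.1, hu.2⟩, fun hu => ⟨⟨hu.1, fun e => hv (e ▸ hu.2)⟩, hu.2⟩⟩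
  rwa [degpIn, degnIn, h.Np_eq hi, h.Nn_eq hi, hn] at hle

/-- If every negative component contains fewer than half of the vertices, then the only nonempty
offensive alliance is the whole vertex set. -/
lemma eq_univ_of_isOffensive [Fintype V] (h : G.IsKAntiBalanced k P)
    (hsmall : ∀ i, 2 * (P i).ncard < Fintype.card V) {S : Set V} (hS : S.Nonempty)
    (hoff : G.IsOffensive S) : S = Set.univ := by
  by_contra hne
  obtain ⟨v, hv⟩ := (Set.ne_univ_iff_exists_notMem S).1 hne
  obtain ⟨i, hi⟩ := h.exists_mem v
  have hvi := h.ncard_compl_inter_le hS hoff hv hi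
  by_cases hsub : (P i)ᶜ ⊆ S
  · rw [Set.inter_eq_left.2 hsub] at hvi
    have hinter : (P i ∩ S).ncard ≤ (P i).ncard := Set.ncard_le_ncard Set.inter_subset_left
    have hcompl := Set.ncard_add_ncard_compl (P i)
    rw [Nat.card_eq_fintype_card] at hcompl
    have := hsmall i
    omega
  · obtain ⟨w, hwi, hw⟩ := Set.not_subset.1 hsub
    obtain ⟨j, hj⟩ := h.exists_mem w
    have hij : i ≠ j := fun e => hwi (e ▸ hj)
    have hwj := h.ncard_compl_inter_le hS hoff hw hj
    have hji : P j ∩ S ⊆ (P i)ᶜ ∩ S := fun u hu =>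
      ⟨fun hui => hij (h.eq_of_mem hui hu.1), hu.2⟩
    have hij' : P i ∩ S ⊆ (P j)ᶜ ∩ S := fun u hu =>
      ⟨fun huj => hij (h.eq_of_mem hu.1 huj), hu.2⟩
    have heq : P i ∩ S = (P j)ᶜ ∩ S :=
      Set.eq_of_subset_of_ncard_le hij' (hwj.trans ((Set.ncard_le_ncard hji).trans hvi))
    obtain ⟨u, hu⟩ : ∃ u, u ∉ P i ∪ P j := by
      by_contra! hall
      have hcard : (P i ∪ P j).ncard = Fintype.card V := by
        rw [Set.eq_univ_of_forall hall, Set.ncard_univ, Nat.card_eq_fintype_card]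
      have := Set.ncard_union_le (P i) (P j)
      have := hsmall i
      have := hsmall j
      omega
    have hSsub : S ⊆ P i ∪ P j := fun x hx => by
      by_cases hxj : x ∈ P j
      · exact Or.inr hxj
      · exact Or.inl (heq.symm.subset ⟨hxj, hx⟩).1
    obtain ⟨l, hl⟩ := h.exists_mem u
    have hSl : S ⊆ (P l)ᶜ := fun x hx hxl => by
      rcases hSsub hx with hxi | hxj
      · exact hu (Or.inl (h.eq_of_mem hxl hxi ▸ hl))
      · exact hu (Or.inr (h.eq_of_mem hxl hxj ▸ hl))
    have hul := h.ncard_compl_inter_le hS hoff (fun huS => hu (hSsub huS)) hl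
    have hempty : P l ∩ S = ∅ := Set.eq_empty_of_forall_notMem fun x hx => hSl hx.2 hx.1
    rw [hempty, Set.ncard_empty, Set.inter_eq_right.2 hSl] at hul
    exact ((Set.ncard_pos).2 hS).not_ge hul

end IsKAntiBalanced

end SignedGraph

theorem signed_anti_balanced_aso_small_components {V : Type*} [Fintype V]
    (G : SignedGraph V) (k : ℕ) (hk : 1 ≤ k) (P : Fin k → Set V)
    (hanti : G.IsKAntiBalanced k P)
    (hsort : ∀ i j : Fin k, i ≤ j → (P j).ncard ≤ (P i).ncard)
    (hsmall : 2 * (P ⟨0, hk⟩).ncard < Fintype.card V)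
    (hnot : ¬ ∃ h : k = 2,
      (Fintype.card V + 3) / 3 ≤ (P ⟨1, by omega⟩).ncard) :
    G.aso = Fintype.card V ∧
      ∀ S : Set V, S.Nonempty → G.IsOffensive S → S = Set.univ := by
  have huniv : ∀ S : Set V, S.Nonempty → G.IsOffensive S → S = Set.univ := fun S hS hoff =>
    hanti.eq_univ_of_isOffensive
      (fun i => (Nat.mul_le_mul_left 2 (hsort ⟨0, hk⟩ i (Nat.zero_le _))).trans_lt hsmall) hS hoff
  refine ⟨?_, huniv⟩
  obtain ⟨v, -⟩ := hanti.1 ⟨0, hk⟩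
  have hset : {n | ∃ S : Set V, S.Nonempty ∧ G.IsOffensive S ∧ S.ncard = n}
      = {Fintype.card V} := by
    ext n
    constructor
    · rintro ⟨S, hS, hoff, rfl⟩
      rw [huniv S hS hoff, Set.ncard_univ, Nat.card_eq_fintype_card, Set.mem_singleton_iff]
    · rintro rfl
      exact ⟨Set.univ, ⟨v, Set.mem_univ v⟩, G.isOffensive_univ, by
        rw [Set.ncard_univ, Nat.card_eq_fintype_card]⟩
  rw [SignedGraph.aso, hset, csInf_singleton]
end

section
/- Let K_n=(V,E⁺,E⁻) be a complete signed graph that is (weakly) k-anti-balanced with negative components V_1,…,V_k. If S is a nonempty offensive alliance of K_n, then S∩V_j ≠ ∅ for every j∈{1,…,k}. -/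
theorem signed_anti_balanced_alliance_meets_all_parts {V : Type*} [Fintype V]
    (G : SignedGraph V) (k : ℕ) (P : Fin k → Set V)
    (hanti : G.IsKAntiBalanced k P)
    (S : Set V) (hne : S.Nonempty) (hS : G.IsOffensive S) :
    ∀ j : Fin k, (S ∩ P j).Nonempty := by
  obtain ⟨hP, hdisj, hcov, hneg, hpos⟩ := hanti
  intro j
  have hpart : ∀ {v : V} {i : Fin k}, v ∈ P j → v ∈ P i → i = j := fun hj hi => by
    by_contra hij
    exact Set.disjoint_left.1 (hdisj _ _ hij) hi hj
  by_contra hempty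
  have havoid : ∀ w ∈ S, w ∉ P j := fun w hw hj => hempty ⟨w, hw, hj⟩
  obtain ⟨v, hv⟩ := hP j
  obtain ⟨u, hu⟩ := hne
  have hvS : v ∉ S := fun h => havoid v h hv
  have huv : G.pos.Adj u v := by
    refine (hpos u v).2 ⟨fun h => hvS (h ▸ hu), ?_⟩
    rintro ⟨i, hui, hvi⟩
    exact havoid u hu (hpart hv hvi ▸ hui)
  have hbd : v ∈ G.boundary S := ⟨Set.mem_biUnion hu (Or.inl huv), hvS⟩
  have hdeg : (G.Nn v ∩ S).ncard ≠ 0 :=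
    Nat.ne_of_gt (Nat.lt_of_lt_of_le (Nat.succ_pos _) (hS v hbd).2)
  obtain ⟨w, hvw, hwS⟩ := Set.nonempty_of_ncard_ne_zero hdeg
  obtain ⟨-, i, hvi, hwi⟩ := (hneg v w).1 hvw
  exact havoid w hwS (hpart hv hvi ▸ hwi)
end

section
/- Let K_n=(V,E⁺,E⁻) be a complete signed graph on n vertices that is (weakly) k-anti-balanced with negative components V_1,…,V_k. If S is a nonempty offensive alliance of K_n and u ∈ ∂S ∩ V_j for some j, then 2|V_j| ≥ |S| ≥ n − |V_j| + 1; in particular, 3|V_j| ≥ n+1. -/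
/-- In an anti-balanced graph, the negative neighborhood of `u ∈ P j` is `P j` without `u`. -/
theorem SignedGraph.IsKAntiBalanced.Nn_eq_s13 {V : Type*} {G : SignedGraph V} {k : ℕ}
    {P : Fin k → Set V} (h : G.IsKAntiBalanced k P) {j : Fin k} {u : V} (hu : u ∈ P j) :
    G.Nn u = P j \ {u} := by
  obtain ⟨-, hdisj, -, hneg, -⟩ := h
  ext v
  simp only [SignedGraph.Nn, Set.mem_ofPred_eq, hneg, Set.mem_sdiff, Set.mem_singleton_iff]
  constructor
  · rintro ⟨hne, i, hui, hvi⟩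
    obtain rfl : i = j := by
      by_contra hij
      exact Set.disjoint_left.mp (hdisj i j hij) hui hu
    exact ⟨hvi, hne.symm⟩
  · rintro ⟨hv, hne⟩
    exact ⟨Ne.symm hne, j, hu, hv⟩

/-- In an anti-balanced graph, the positive neighborhood of `u ∈ P j` is the complement of
`P j`. -/
theorem SignedGraph.IsKAntiBalanced.Np_eq_s13 {V : Type*} {G : SignedGraph V} {k : ℕ}
    {P : Fin k → Set V} (h : G.IsKAntiBalanced k P) {j : Fin k} {u : V} (hu : u ∈ P j) :
    G.Np u = (P j)ᶜ := by
  have hn := h.Nn_eq_s13 hu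
  obtain ⟨-, -, -, hneg, hpos⟩ := h
  ext v
  have hv := Set.ext_iff.mp hn v
  simp only [SignedGraph.Nn, Set.mem_ofPred_eq, hneg, Set.mem_sdiff,
    Set.mem_singleton_iff] at hv
  simp only [SignedGraph.Np, Set.mem_ofPred_eq, hpos, Set.mem_compl_iff]
  by_cases huv : u = v
  · subst huv
    simp [hu]
  · rw [and_iff_right huv, and_iff_left (Ne.symm huv : ¬v = u)] at hv
    rw [and_iff_right huv, hv]

theorem signed_anti_balanced_boundary_part_bounds {V : Type*} [Fintype V]
    (G : SignedGraph V) (k : ℕ) (P : Fin k → Set V)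
    (hanti : G.IsKAntiBalanced k P)
    (S : Set V) (hne : S.Nonempty) (hS : G.IsOffensive S)
    (j : Fin k) (u : V) (hu : u ∈ G.boundary S ∩ P j) :
    S.ncard ≤ 2 * (P j).ncard ∧
      Fintype.card V - (P j).ncard + 1 ≤ S.ncard ∧
      Fintype.card V + 1 ≤ 3 * (P j).ncard := by
  obtain ⟨hub, huP⟩ := hu
  obtain ⟨h₁, h₂⟩ := hS u hub
  have huS : u ∉ S := hub.2
  have hN : (P j \ {u}) ∩ S = S ∩ P j := by
    ext v
    simp only [Set.mem_inter_iff, Set.mem_sdiff, Set.mem_singleton_iff]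
    constructor
    · tauto
    · rintro ⟨hvS, hvP⟩
      exact ⟨⟨hvP, fun hvu => huS (hvu ▸ hvS)⟩, hvS⟩
  simp only [SignedGraph.degpIn, SignedGraph.degnIn, hanti.Nn_eq_s13 huP, hanti.Np_eq_s13 huP, hN]
    at h₁ h₂
  have hsplit : (S ∩ P j).ncard + ((P j)ᶜ ∩ S).ncard = S.ncard := by
    rw [Set.inter_comm (P j)ᶜ, ← Set.sdiff_eq]
    exact Set.ncard_inter_add_ncard_sdiff_eq_ncard S (P j) S.toFinite
  have hcompl : ((P j)ᶜ ∩ S).ncard + ((P j)ᶜ ∩ Sᶜ).ncard = (P j)ᶜ.ncard := by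
    rw [← Set.sdiff_eq]
    exact Set.ncard_inter_add_ncard_sdiff_eq_ncard (P j)ᶜ S (Set.toFinite _)
  have hcard : (P j).ncard + (P j)ᶜ.ncard = Fintype.card V := by
    rw [Set.ncard_add_ncard_compl, Nat.card_eq_fintype_card]
  have hle : (S ∩ P j).ncard ≤ (P j).ncard :=
    Set.ncard_le_ncard Set.inter_subset_right (Set.toFinite _)
  omega
end

section
/- Let K_n=(V,E⁺,E⁻) be a complete signed graph that is (weakly) k-balanced with positive components V_1,…,V_k, |V_1| ≥ … ≥ |V_k|. Then every nonempty offensive alliance S of K_n satisfies |S| ≥ |V_1|. -/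
theorem signed_balanced_alliance_lower_bound {V : Type*} [Fintype V]
    (G : SignedGraph V) (k : ℕ) (hk : 1 ≤ k) (P : Fin k → Set V)
    (hbal : G.IsKBalanced k P)
    (hsort : ∀ i j : Fin k, i ≤ j → (P j).ncard ≤ (P i).ncard)
    (S : Set V) (hne : S.Nonempty) (hS : G.IsOffensive S) :
    (P ⟨0, hk⟩).ncard ≤ S.ncard := by
  obtain ⟨-, -, -, hpos, hneg⟩ := hbal
  set A := P ⟨0, hk⟩
  by_cases hsub : A ⊆ S
  · exact Set.ncard_le_ncard hsub S.toFinite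
  obtain ⟨v, hvA, hvS⟩ := Set.not_subset.mp hsub
  obtain ⟨u, huS⟩ := hne
  have huv : u ≠ v := fun h => hvS (h ▸ huS)
  have hbd : v ∈ G.boundary S := by
    refine ⟨Set.mem_biUnion huS ?_, hvS⟩
    by_cases h : ∃ i, u ∈ P i ∧ v ∈ P i
    · exact Or.inl ((hpos u v).2 ⟨huv, h⟩)
    · exact Or.inr ((hneg u v).2 ⟨huv, h⟩)
  have hdiff : (A \ S).ncard ≤ G.degpIn Sᶜ v + 1 := by
    have hincl : A \ S ⊆ insert v (G.Np v ∩ Sᶜ) := by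
      rintro w ⟨hwA, hwS⟩
      by_cases hwv : w = v
      · exact Or.inl hwv
      · exact Or.inr ⟨(hpos v w).2 ⟨Ne.symm hwv, _, hvA, hwA⟩, hwS⟩
    exact (Set.ncard_le_ncard hincl (Set.toFinite _)).trans (Set.ncard_insert_le _ _)
  have hneg_le : G.degnIn S v ≤ (S \ A).ncard := by
    refine Set.ncard_le_ncard ?_ (Set.toFinite _)
    rintro w ⟨hwN, hwS⟩
    exact ⟨hwS, fun hwA => ((hneg v w).1 hwN).2 ⟨_, hvA, hwA⟩⟩
  have hle : (A \ S).ncard ≤ (S \ A).ncard := hdiff.trans ((hS v hbd).2.trans hneg_le)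
  have hAcard := Set.ncard_inter_add_ncard_sdiff_eq_ncard A S A.toFinite
  have hScard := Set.ncard_inter_add_ncard_sdiff_eq_ncard S A S.toFinite
  rw [Set.inter_comm] at hScard
  omega
end

section
/- Let G=(V,E⁺,E⁻) be a signed graph and let D ⊆ V be such that the induced signed subgraph G−D is a complete signed graph that is (weakly) k-balanced. Then snd(G) ≤ k·3^{|D|} + |D|. -/
namespace SignedGraph

variable {V : Type*}

/-- A colouring whose colour classes consist of vertices with equal signed neighborhoods up to
each other bounds the signed neighborhood diversity by the number of colours. -/
theorem snd_le_card_of_coloring {α : Type*} [Fintype α] (G : SignedGraph V) (f : V → α)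
    (hf : ∀ u v, f u = f v →
      G.Np v \ {u} = G.Np u \ {v} ∧ G.Nn v \ {u} = G.Nn u \ {v}) :
    G.snd ≤ Fintype.card α := by
  let e := Fintype.equivFin α
  refine Nat.sInf_le ⟨fun i => {v | e (f v) = i}, ?_, ?_, ?_⟩
  · ext v
    simp
  · intro i j hij
    rw [Set.disjoint_left]
    rintro v rfl rfl
    exact hij rfl
  · intro i u hu v hv
    exact hf u v (e.injective (hu.trans hv.symm))

/-- The sign of the pair `u v`: `0` for a positive edge, `1` for a negative edge, and `2` for a
non-edge. -/
noncomputable def sign (G : SignedGraph V) (u v : V) : Fin 3 :=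
  open Classical in if G.pos.Adj u v then 0 else if G.neg.Adj u v then 1 else 2

theorem sign_eq_zero_iff (G : SignedGraph V) (u v : V) : G.sign u v = 0 ↔ G.pos.Adj u v := by
  unfold sign
  split_ifs <;> simp_all

theorem sign_eq_one_iff (G : SignedGraph V) (u v : V) : G.sign u v = 1 ↔ G.neg.Adj u v := by
  have := G.disj u v
  unfold sign
  split_ifs <;> simp_all

theorem diff_eq_of_sign_eq (G : SignedGraph V) {u v : V}
    (h : ∀ w, w ≠ u → w ≠ v → G.sign u w = G.sign v w) :
    G.Np v \ {u} = G.Np u \ {v} ∧ G.Nn v \ {u} = G.Nn u \ {v} := by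
  have key (H : SimpleGraph V) (hH : ∀ w, w ≠ u → w ≠ v → (H.Adj u w ↔ H.Adj v w)) :
      {w | H.Adj v w} \ {u} = {w | H.Adj u w} \ {v} := by
    ext w
    have hu : H.Adj u w → w ≠ u := fun h => h.ne'
    have hv : H.Adj v w → w ≠ v := fun h => h.ne'
    have := hH w
    simp only [Set.mem_sdiff, Set.mem_ofPred_eq, Set.mem_singleton_iff]
    tauto
  refine ⟨key G.pos fun w hu hv => ?_, key G.neg fun w hu hv => ?_⟩
  · rw [← sign_eq_zero_iff, ← sign_eq_zero_iff, h w hu hv]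
  · rw [← sign_eq_one_iff, ← sign_eq_one_iff, h w hu hv]

/-- In a balanced graph, two vertices of the same part have the same sign towards any third
vertex. -/
theorem IsKBalanced.sign_eq {G : SignedGraph V} {k : ℕ} {P : Fin k → Set V}
    (h : G.IsKBalanced k P) {i : Fin k} {u v w : V} (hu : u ∈ P i) (hv : v ∈ P i)
    (hwu : w ≠ u) (hwv : w ≠ v) : G.sign u w = G.sign v w := by
  obtain ⟨-, hdisj, -, hpos, hneg⟩ := h
  have same_part {x : V} (hx : x ∈ P i) : (∃ j, x ∈ P j ∧ w ∈ P j) ↔ w ∈ P i := by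
    refine ⟨fun ⟨j, hxj, hwj⟩ => ?_, fun hw => ⟨i, hx, hw⟩⟩
    by_cases hij : i = j
    · exact hij ▸ hwj
    · exact absurd hxj (Set.disjoint_left.mp (hdisj i j hij) hx)
  have hp : G.pos.Adj u w ↔ G.pos.Adj v w := by
    simp only [hpos, same_part hu, same_part hv, ne_eq, hwu.symm, hwv.symm]
  have hn : G.neg.Adj u w ↔ G.neg.Adj v w := by
    simp only [hneg, same_part hu, same_part hv, ne_eq, hwu.symm, hwv.symm]
  unfold sign
  split_ifs <;> tauto

end SignedGraph

theorem signed_snd_le_distance_to_balanced {V : Type*} [Fintype V]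
    (G : SignedGraph V) (D : Set V) (k : ℕ) (P : Fin k → Set ↥(Dᶜ))
    (hbal : (G.restrict Dᶜ).IsKBalanced k P) :
    G.snd ≤ k * 3 ^ D.ncard + D.ncard := by
  classical
  have hcover (v : ↥Dᶜ) : ∃ i, v ∈ P i := by
    simpa using hbal.2.2.1.symm.subset (Set.mem_univ v)
  choose part hpart using hcover
  let f (v : V) : (Fin k × (D → Fin 3)) ⊕ D :=
    if hv : v ∈ D then .inr ⟨v, hv⟩ else .inl (part ⟨v, hv⟩, fun d => G.sign v d)
  have hf : G.snd ≤ Fintype.card ((Fin k × (D → Fin 3)) ⊕ D) := by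
    refine G.snd_le_card_of_coloring f fun u v huv => G.diff_eq_of_sign_eq fun w hwu hwv => ?_
    by_cases hu : u ∈ D <;> by_cases hv : v ∈ D <;>
      simp only [f, hu, hv, dite_true, dite_false, reduceCtorEq, Sum.inr.injEq, Sum.inl.injEq,
        Prod.mk.injEq, Subtype.mk.injEq] at huv
    · rw [huv]
    · by_cases hw : w ∈ D
      · exact congrFun huv.2 ⟨w, hw⟩
      · exact hbal.sign_eq (u := ⟨u, hu⟩) (v := ⟨v, hv⟩) (w := ⟨w, hw⟩) (hpart _)
          (huv.1 ▸ hpart _) (by simpa using hwu) (by simpa using hwv)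
  simpa [Set.ncard_eq_toFinset_card'] using hf
end
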